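/- arXiv:1807.08779 — 2 statements merged into one kernel-verified Lean document; each statement's English description precedes it below -/
import Mathlib

section
/- Let $v \in \mathbb{C}^{d_1}$ be a fixed vector with $\|v\|_2 = 1$, let $d_2 < d_1$ with $d_2$ dividing $d_1$, and let $\epsilon > 0$. Let $U$ be a random $d_1 \times d_1$ unitary matrix distributed according to the Haar probability measure on the unitary group. Then for any fixed block index $i$ with $1 \leq i \leq d_1/d_2$, $\Pr_U\left[\|\Pi_i U v\|_2 \notin [(1-\epsilon)\sqrt{d_2/d_1},\, (1+\epsilon)\sqrt{d_2/d_1}]\right] \leq 4 \exp(-2^{-4}\epsilon^2 d_2)$. -/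
open MeasureTheory Matrix

noncomputable section

/-- The Borel/product measurable structure on matrices over `ℂ`. -/
instance {d : ℕ} : MeasurableSpace (Matrix (Fin d) (Fin d) ℂ) :=
  inferInstanceAs (MeasurableSpace (Fin d → Fin d → ℂ))

/-- The Euclidean (`ℓ₂`) norm of a vector in `ℂ^d`. -/
def l2norm {d : ℕ} (v : Fin d → ℂ) : ℝ := Real.sqrt (∑ a, ‖v a‖ ^ 2)

/-- The orthogonal projection of `ℂ^{d₁}` onto the (0-indexed) `i`-th consecutive block of
`d₂` coordinates. -/
def blockProj (d1 d2 i : ℕ) : Matrix (Fin d1) (Fin d1) ℂ :=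
  Matrix.diagonal fun a => if a.val / d2 = i then 1 else 0


/-- squared norm -/
def nsq {d : ℕ} (z : Fin d → ℂ) : ℝ := ∑ a, ‖z a‖ ^ 2

/-- squared norm of the block -/
def qsq {d : ℕ} (c : Fin d → ℝ) (z : Fin d → ℂ) : ℝ := ∑ a, c a * ‖z a‖ ^ 2

lemma gauss_one (b : ℝ) (hb : 0 < b) : ∫ z : ℂ, Real.exp (-b * ‖z‖ ^ 2) = Real.pi / b := by
  have := GaussianFourier.integral_rexp_neg_mul_sq_norm (V := ℂ) hb
  rw [this]
  simp

lemma gauss_one_int (b : ℝ) (hb : 0 < b) : Integrable (fun z : ℂ => Real.exp (-b * ‖z‖ ^ 2)) := by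
  by_contra h
  have h1 := gauss_one b hb
  rw [integral_undef h] at h1
  have : 0 < Real.pi / b := by positivity
  linarith

lemma gauss_lint {d : ℕ} (b : Fin d → ℝ) (hb : ∀ a, 0 < b a) :
    ∫⁻ z : Fin d → ℂ, ENNReal.ofReal (Real.exp (-qsq b z)) = ENNReal.ofReal (∏ a, Real.pi / b a) := by
  have e : ∀ z : Fin d → ℂ, Real.exp (-qsq b z) = ∏ a, Real.exp (-b a * ‖z a‖ ^ 2) := by
    intro z
    rw [← Real.exp_sum, qsq]
    simp
  have hint : Integrable (fun z : Fin d → ℂ => ∏ a, Real.exp (-b a * ‖z a‖ ^ 2)) :=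
    Integrable.fintype_prod (f := fun a (w : ℂ) => Real.exp (-b a * ‖w‖ ^ 2))
      (fun a => gauss_one_int (b a) (hb a))
  simp_rw [e]
  rw [← ofReal_integral_eq_lintegral_ofReal hint
    (Filter.Eventually.of_forall fun z => Finset.prod_nonneg fun a _ => (Real.exp_pos _).le)]
  rw [integral_fintype_prod_volume_eq_prod (fun a (w : ℂ) => Real.exp (-b a * ‖w‖ ^ 2))]
  simp_rw [gauss_one _ (hb _)]

lemma nsq_unitary {d : ℕ} (W : Matrix.unitaryGroup (Fin d) ℂ) (z : Fin d → ℂ) :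
    nsq ((W : Matrix (Fin d) (Fin d) ℂ).mulVec z) = nsq z := by
  have key : ∀ z : Fin d → ℂ, ((nsq z : ℝ) : ℂ) = star z ⬝ᵥ z := by
    intro z
    simp only [nsq, dotProduct, Pi.star_apply]
    push_cast
    refine Finset.sum_congr rfl fun a _ => ?_
    rw [mul_comm]
    exact (Complex.mul_conj' (z a)).symm
  apply Complex.ofReal_injective
  rw [key, key, star_mulVec, dotProduct_mulVec, vecMul_vecMul, ← star_eq_conjTranspose,
    (Matrix.mem_unitaryGroup_iff').1 W.2, vecMul_one]

lemma exists_unitary {d : ℕ} (x z : Fin d → ℂ) (h : nsq x = nsq z) :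
    ∃ W : Matrix.unitaryGroup (Fin d) ℂ, (W : Matrix (Fin d) (Fin d) ℂ).mulVec x = z := by
  have hn : ∀ x : Fin d → ℂ, ‖(WithLp.toLp 2 x : EuclideanSpace ℂ (Fin d))‖ ^ 2 = nsq x := by
    intro x
    rw [EuclideanSpace.norm_sq_eq]
    rfl
  -- orthonormal basis through a direction
  have hb : ∀ x : Fin d → ℂ, nsq x ≠ 0 → ∃ (k : Fin d) (b : OrthonormalBasis (Fin d) ℂ (EuclideanSpace ℂ (Fin d))),
      k.val = 0 ∧ WithLp.toLp 2 x = ((Real.sqrt (nsq x) : ℝ) : ℂ) • b k := by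
    intro x hx
    have hd : 0 < d := by
      rcases Nat.eq_zero_or_pos d with h0 | h0
      · subst h0
        simp [nsq] at hx
      · exact h0
    have hs : Real.sqrt (nsq x) = ‖(WithLp.toLp 2 x : EuclideanSpace ℂ (Fin d))‖ := by
      rw [← hn, Real.sqrt_sq (norm_nonneg _)]
    have hs0 : Real.sqrt (nsq x) ≠ 0 := by
      rw [hs]
      intro h0
      rw [← hn, h0] at hx
      simp at hx
    let u : EuclideanSpace ℂ (Fin d) := ((Real.sqrt (nsq x) : ℝ) : ℂ)⁻¹ • WithLp.toLp 2 x
    have hu : ‖u‖ = 1 := by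
      simp only [u, norm_smul, norm_inv, Complex.norm_real, ← hs, Real.norm_eq_abs,
        abs_of_nonneg (Real.sqrt_nonneg _)]
      exact inv_mul_cancel₀ hs0
    obtain ⟨b, hb⟩ := Orthonormal.exists_orthonormalBasis_extension_of_card_eq
      (𝕜 := ℂ) (E := EuclideanSpace ℂ (Fin d)) (ι := Fin d) (by simp)
      (v := fun _ => u) (s := {⟨0, hd⟩}) (by
        constructor
        · intro i
          simpa using hu
        · intro i j hij
          exact absurd (Subsingleton.elim i j) hij)
    refine ⟨⟨0, hd⟩, b, rfl, ?_⟩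
    rw [hb _ (Set.mem_singleton _)]
    simp only [u]
    rw [smul_smul, mul_inv_cancel₀ (by exact_mod_cast hs0), one_smul]
  by_cases hx : nsq x = 0
  · have h0 : ∀ x : Fin d → ℂ, nsq x = 0 → x = 0 := by
      intro x hx
      rw [← hn] at hx
      have : (WithLp.toLp 2 x : EuclideanSpace ℂ (Fin d)) = 0 := by simpa using hx
      simpa using this
    refine ⟨1, ?_⟩
    rw [h0 x hx, h0 z (h ▸ hx)]
    simp
  · obtain ⟨k, b, hk, hxb⟩ := hb x hx
    obtain ⟨k', b', hk', hzb⟩ := hb z (h ▸ hx)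
    have hkk : k' = k := Fin.ext (hk'.trans hk.symm)
    subst hkk
    let f := b.equiv b' (Equiv.refl _)
    let e := EuclideanSpace.basisFun (Fin d) ℂ
    refine ⟨⟨_, f.toMatrix_mem_unitaryGroup e e⟩, ?_⟩
    have hf : f (WithLp.toLp 2 x) = WithLp.toLp 2 z := by
      rw [hxb, hzb, map_smul, h]
      simp [f]
    have := LinearMap.toMatrix_mulVec_repr e.toBasis e.toBasis f.toLinearEquiv.toLinearMap (WithLp.toLp 2 x)
    have hr : ∀ y : EuclideanSpace ℂ (Fin d), (e.toBasis.repr y : Fin d → ℂ) = y.ofLp := by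
      intro y
      ext a
      simp [e]
    rw [hr, hr] at this
    simp at this
    rw [hf] at this
    exact this

lemma meas_mulVec {d : ℕ} : Measurable
    (fun p : Matrix (Fin d) (Fin d) ℂ × (Fin d → ℂ) => p.1.mulVec p.2) := by
  refine measurable_pi_lambda _ fun a => ?_
  simp only [Matrix.mulVec, dotProduct]
  refine Finset.measurable_sum _ fun b _ => ?_
  refine Measurable.mul ?_ ((measurable_pi_apply b).comp measurable_snd)
  exact (measurable_pi_apply b).comp ((measurable_pi_apply a).comp measurable_fst)

lemma meas_star {d : ℕ} : Measurable (fun U : Matrix (Fin d) (Fin d) ℂ => star U) := by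
  refine measurable_pi_lambda _ fun a => measurable_pi_lambda _ fun b => ?_
  have : Measurable (fun U : Matrix (Fin d) (Fin d) ℂ => U b a) :=
    (measurable_pi_apply a).comp (measurable_pi_apply b)
  exact Complex.continuous_conj.measurable.comp this

lemma meas_mul_left {d : ℕ} (V : Matrix.unitaryGroup (Fin d) ℂ) :
    Measurable (fun U : Matrix.unitaryGroup (Fin d) ℂ => V * U) := by
  apply Measurable.subtype_mk
  refine measurable_pi_lambda _ fun a => measurable_pi_lambda _ fun b => ?_
  simp only [Matrix.mul_apply]
  refine Finset.measurable_sum _ fun c _ => ?_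
  refine Measurable.mul measurable_const ?_
  exact (measurable_pi_apply b).comp ((measurable_pi_apply c).comp measurable_subtype_coe)

lemma vol_unitary {d : ℕ} (W : Matrix.unitaryGroup (Fin d) ℂ) (f : (Fin d → ℂ) → ENNReal)
    (hf : Measurable f) :
    ∫⁻ z, f ((W : Matrix (Fin d) (Fin d) ℂ).mulVec z) = ∫⁻ z, f z := by
  let L : (Fin d → ℂ) →ₗ[ℝ] (Fin d → ℂ) :=
    (Matrix.mulVecLin (W : Matrix (Fin d) (Fin d) ℂ)).restrictScalars ℝ
  let L' : (Fin d → ℂ) →ₗ[ℝ] (Fin d → ℂ) :=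
    (Matrix.mulVecLin (star W : Matrix (Fin d) (Fin d) ℂ)).restrictScalars ℝ
  have hLL : L ∘ₗ L' = LinearMap.id := by
    apply LinearMap.ext
    intro z
    simp [L, L', Matrix.mulVec_mulVec, Matrix.mem_unitaryGroup_iff.1 W.2]
  have hdet : LinearMap.det L ≠ 0 := by
    intro h
    have := congrArg LinearMap.det hLL
    rw [LinearMap.det_comp, h] at this
    simp at this
  have hmap := Measure.map_linearMap_addHaar_eq_smul_addHaar (volume : Measure (Fin d → ℂ)) hdet
  have hm : Measurable L := meas_mulVec.comp (measurable_const.prodMk measurable_id)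
  set c := ENNReal.ofReal |(LinearMap.det L)⁻¹|
  have hgen : ∀ f : (Fin d → ℂ) → ENNReal, Measurable f →
      ∫⁻ z, f ((W : Matrix (Fin d) (Fin d) ℂ).mulVec z) = c * ∫⁻ z, f z := by
    intro f hf
    have := lintegral_map (μ := volume) hf hm
    rw [hmap, lintegral_smul_measure] at this
    exact this.symm
  have hc : c = 1 := by
    have h1 := gauss_lint (d := d) (fun _ => 1) (fun _ => one_pos)
    have hq : ∀ z : Fin d → ℂ, qsq (fun _ => 1) z = nsq z := by
      intro z
      simp [qsq, nsq]
    simp_rw [hq] at h1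
    have h2 := hgen (fun z => ENNReal.ofReal (Real.exp (-nsq z))) (by unfold nsq; fun_prop)
    simp_rw [nsq_unitary, h1] at h2
    have hp : ENNReal.ofReal (∏ a : Fin d, Real.pi / 1) ≠ 0 := by
      simp [Real.pi_pos]
    exact ((ENNReal.mul_eq_right hp ENNReal.ofReal_ne_top).1 h2.symm)
  rw [hgen f hf, hc, one_mul]

lemma aux_pos (s t : ℝ) (hs : s < 1) (h0 : 0 ≤ t) (h1 : t ≤ 1) : 0 < 1 - s * t := by
  rcases le_or_gt s 0 with h | h
  · have := mul_nonpos_of_nonpos_of_nonneg h h0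
    linarith
  · have := mul_le_of_le_one_right h.le h1
    linarith

lemma meas_qsq {d : ℕ} (c : Fin d → ℝ) : Measurable (qsq c) := by
  unfold qsq
  fun_prop

lemma avg {d : ℕ} (μ : Measure (Matrix.unitaryGroup (Fin d) ℂ)) [IsProbabilityMeasure μ]
    (hinv : ∀ V : Matrix.unitaryGroup (Fin d) ℂ, μ.map (fun U => V * U) = μ)
    (f : (Fin d → ℂ) → ENNReal) (hf : Measurable f) (y z : Fin d → ℂ) (h : nsq y = nsq z) :
    ∫⁻ K, f ((star (K : Matrix (Fin d) (Fin d) ℂ)).mulVec z) ∂μ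
      = ∫⁻ U, f ((U : Matrix (Fin d) (Fin d) ℂ).mulVec y) ∂μ := by
  have hl : ∀ (V : Matrix.unitaryGroup (Fin d) ℂ) (g : Matrix.unitaryGroup (Fin d) ℂ → ENNReal),
      Measurable g → ∫⁻ U, g (V * U) ∂μ = ∫⁻ U, g U ∂μ := by
    intro V g hg
    have := lintegral_map (μ := μ) hg (meas_mul_left V)
    rw [hinv V] at this
    exact this.symm
  have m1 : ∀ y : Fin d → ℂ, Measurable
      (fun U : Matrix.unitaryGroup (Fin d) ℂ => (U : Matrix (Fin d) (Fin d) ℂ).mulVec y) :=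
    fun y => meas_mulVec.comp (measurable_subtype_coe.prodMk measurable_const)
  have m2 : ∀ y : Fin d → ℂ, Measurable
      (fun U : Matrix.unitaryGroup (Fin d) ℂ => (star (U : Matrix (Fin d) (Fin d) ℂ)).mulVec y) :=
    fun y => meas_mulVec.comp ((meas_star.comp measurable_subtype_coe).prodMk measurable_const)
  have step1 : ∀ K : Matrix.unitaryGroup (Fin d) ℂ,
      ∫⁻ U, f ((star (K : Matrix (Fin d) (Fin d) ℂ)).mulVec
        ((U : Matrix (Fin d) (Fin d) ℂ).mulVec y)) ∂μ
      = ∫⁻ U, f ((U : Matrix (Fin d) (Fin d) ℂ).mulVec y) ∂μ := by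
    intro K
    rw [← hl (star K) (fun U => f ((U : Matrix (Fin d) (Fin d) ℂ).mulVec y)) (hf.comp (m1 y))]
    simp [Matrix.mulVec_mulVec]
  have step2 : ∀ U : Matrix.unitaryGroup (Fin d) ℂ,
      ∫⁻ K, f ((star (K : Matrix (Fin d) (Fin d) ℂ)).mulVec
        ((U : Matrix (Fin d) (Fin d) ℂ).mulVec y)) ∂μ
      = ∫⁻ K, f ((star (K : Matrix (Fin d) (Fin d) ℂ)).mulVec z) ∂μ := by
    intro U
    obtain ⟨W, hW⟩ := exists_unitary z ((U : Matrix (Fin d) (Fin d) ℂ).mulVec y)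
      (by rw [nsq_unitary, h])
    rw [← hW]
    rw [← hl W (fun K => f ((star (K : Matrix (Fin d) (Fin d) ℂ)).mulVec
      ((W : Matrix (Fin d) (Fin d) ℂ).mulVec z))) (hf.comp (m2 _))]
    refine lintegral_congr fun K => ?_
    congr 1
    rw [Matrix.mulVec_mulVec, Submonoid.coe_mul, star_mul, mul_assoc,
      Matrix.mem_unitaryGroup_iff'.1 W.2, mul_one]
  have mm : Measurable (fun p : Matrix.unitaryGroup (Fin d) ℂ × Matrix.unitaryGroup (Fin d) ℂ =>
      (star (p.1 : Matrix (Fin d) (Fin d) ℂ), (p.2 : Matrix (Fin d) (Fin d) ℂ).mulVec y)) :=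
    Measurable.prodMk (meas_star.comp (measurable_subtype_coe.comp measurable_fst))
      ((m1 y).comp measurable_snd)
  have mm2 := hf.comp (meas_mulVec.comp mm)
  have swap := lintegral_lintegral_swap (μ := μ) (ν := μ)
    (f := fun K U => f ((star (K : Matrix (Fin d) (Fin d) ℂ)).mulVec
        ((U : Matrix (Fin d) (Fin d) ℂ).mulVec y))) mm2.aemeasurable
  simp_rw [step1, step2] at swap
  simpa using swap.symm

lemma qsq_smul {d : ℕ} (c : Fin d → ℝ) (r : ℝ) (z : Fin d → ℂ) :
    qsq c ((r : ℂ) • z) = r ^ 2 * qsq c z := by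
  simp only [qsq, Finset.mul_sum]
  refine Finset.sum_congr rfl fun a _ => ?_
  simp [mul_pow]
  ring

lemma nsq_eq {d : ℕ} (z : Fin d → ℂ) : nsq z = qsq (fun _ => 1) z := by
  simp [nsq, qsq]

lemma nsq_nonneg {d : ℕ} (z : Fin d → ℂ) : 0 ≤ nsq z :=
  Finset.sum_nonneg fun _ _ => by positivity

lemma main_identity {d : ℕ} (μ : Measure (Matrix.unitaryGroup (Fin d) ℂ)) [IsProbabilityMeasure μ]
    (hinv : ∀ V : Matrix.unitaryGroup (Fin d) ℂ, μ.map (fun U => V * U) = μ)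
    (v : Fin d → ℂ) (hv : nsq v = 1) (c : Fin d → ℝ) (hc0 : ∀ a, 0 ≤ c a) (hc1 : ∀ a, c a ≤ 1)
    (s : ℝ) (hs : s < 1) :
    ∫⁻ U, ENNReal.ofReal
      ((Real.pi / (1 - s * qsq c ((U : Matrix (Fin d) (Fin d) ℂ).mulVec v))) ^ d) ∂μ
      = ENNReal.ofReal (∏ a, Real.pi / (1 - s * c a)) := by
  have hpos : ∀ t : ℝ, 0 ≤ t → t ≤ 1 → 0 < 1 - s * t := by
    intro t h0 h1
    exact aux_pos s t hs h0 h1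
  let F : (Fin d → ℂ) → ENNReal := fun z => ENNReal.ofReal (Real.exp (-qsq (fun a => 1 - s * c a) z))
  have hF : Measurable F := by
    have := meas_qsq (fun a => 1 - s * c a)
    fun_prop
  have hFe : ∀ z, qsq (fun a => 1 - s * c a) z = nsq z - s * qsq c z := by
    intro z
    simp only [qsq, nsq, Finset.mul_sum, ← Finset.sum_sub_distrib]
    exact Finset.sum_congr rfl fun a _ => by ring
  have h1 : ∀ U : Matrix.unitaryGroup (Fin d) ℂ,
      ∫⁻ z, F ((star (U : Matrix (Fin d) (Fin d) ℂ)).mulVec z)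
      = ENNReal.ofReal (∏ a, Real.pi / (1 - s * c a)) := by
    intro U
    have := vol_unitary (star U) F hF
    rw [← gauss_lint _ (fun a => hpos (c a) (hc0 a) (hc1 a)), ← this]
    rfl
  have h2 : ∀ z : Fin d → ℂ, ∫⁻ K, F ((star (K : Matrix (Fin d) (Fin d) ℂ)).mulVec z) ∂μ
      = ∫⁻ U, F (((Real.sqrt (nsq z) : ℝ) : ℂ) • (U : Matrix (Fin d) (Fin d) ℂ).mulVec v) ∂μ := by
    intro z
    rw [avg μ hinv F hF (((Real.sqrt (nsq z) : ℝ) : ℂ) • v) z (by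
      rw [nsq_eq, qsq_smul, ← nsq_eq, hv, mul_one, Real.sq_sqrt (nsq_nonneg z)])]
    simp_rw [Matrix.mulVec_smul]
  have h3 : ∀ U : Matrix.unitaryGroup (Fin d) ℂ,
      ∫⁻ z : Fin d → ℂ, F (((Real.sqrt (nsq z) : ℝ) : ℂ) • (U : Matrix (Fin d) (Fin d) ℂ).mulVec v)
      = ENNReal.ofReal
      ((Real.pi / (1 - s * qsq c ((U : Matrix (Fin d) (Fin d) ℂ).mulVec v))) ^ d) := by
    intro U
    set w := (U : Matrix (Fin d) (Fin d) ℂ).mulVec v with hw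
    have hw1 : nsq w = 1 := by rw [hw, nsq_unitary, hv]
    have hq0 : 0 ≤ qsq c w := Finset.sum_nonneg fun a _ => mul_nonneg (hc0 a) (by positivity)
    have hq1 : qsq c w ≤ 1 := by
      rw [← hw1]
      exact Finset.sum_le_sum fun a _ => mul_le_of_le_one_left (by positivity) (hc1 a)
    have := gauss_lint (d := d) (fun _ => 1 - s * qsq c w) (fun _ => hpos _ hq0 hq1)
    simp only [Finset.prod_const, Finset.card_univ, Fintype.card_fin] at this
    rw [← this]
    refine lintegral_congr fun z => ?_
    simp only [F]
    rw [qsq_smul, Real.sq_sqrt (nsq_nonneg z), hFe, hw1]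
    simp only [qsq, nsq, Finset.mul_sum, Finset.sum_mul]
    congr 4
    exact funext fun a => by ring
  have m1 : Measurable (fun p : (Fin d → ℂ) × Matrix.unitaryGroup (Fin d) ℂ =>
      F ((star (p.2 : Matrix (Fin d) (Fin d) ℂ)).mulVec p.1)) :=
    hF.comp (meas_mulVec.comp (Measurable.prodMk
      (meas_star.comp (measurable_subtype_coe.comp measurable_snd)) measurable_fst))
  have m2 : Measurable (fun p : (Fin d → ℂ) × Matrix.unitaryGroup (Fin d) ℂ =>
      F (((Real.sqrt (nsq p.1) : ℝ) : ℂ) • (p.2 : Matrix (Fin d) (Fin d) ℂ).mulVec v)) := by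
    have a1 : Measurable (fun p : (Fin d → ℂ) × Matrix.unitaryGroup (Fin d) ℂ =>
        (p.2 : Matrix (Fin d) (Fin d) ℂ).mulVec v) :=
      meas_mulVec.comp ((measurable_subtype_coe.comp measurable_snd).prodMk measurable_const)
    have a2 : Measurable (nsq : (Fin d → ℂ) → ℝ) := by
      unfold nsq
      fun_prop
    have a3 : Measurable (fun p : (Fin d → ℂ) × Matrix.unitaryGroup (Fin d) ℂ =>
        ((Real.sqrt (nsq p.1) : ℝ) : ℂ)) := by fun_prop
    exact hF.comp (a3.smul a1)
  have s1 := lintegral_lintegral_swap (μ := volume) (ν := μ)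
    (f := fun (z : Fin d → ℂ) (K : Matrix.unitaryGroup (Fin d) ℂ) =>
      F ((star (K : Matrix (Fin d) (Fin d) ℂ)).mulVec z)) m1.aemeasurable
  have s2 := lintegral_lintegral_swap (μ := volume) (ν := μ)
    (f := fun (z : Fin d → ℂ) (U : Matrix.unitaryGroup (Fin d) ℂ) =>
      F (((Real.sqrt (nsq z) : ℝ) : ℂ) • (U : Matrix (Fin d) (Fin d) ℂ).mulVec v)) m2.aemeasurable
  simp_rw [h1, h2] at s1
  simp_rw [h3] at s2
  rw [← s2, s1]
  simp

lemma mgf_bound {d k : ℕ} (μ : Measure (Matrix.unitaryGroup (Fin d) ℂ)) [IsProbabilityMeasure μ]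
    (hinv : ∀ V : Matrix.unitaryGroup (Fin d) ℂ, μ.map (fun U => V * U) = μ)
    (v : Fin d → ℂ) (hv : nsq v = 1) (P : Fin d → Prop) [DecidablePred P]
    (hk : (Finset.univ.filter P).card = k)
    (s : ℝ) (hs : s < 1) :
    ∫⁻ U, ENNReal.ofReal (Real.exp
      (d * s * qsq (fun a => if P a then 1 else 0) ((U : Matrix (Fin d) (Fin d) ℂ).mulVec v))) ∂μ
      ≤ ENNReal.ofReal (((1 - s)⁻¹) ^ k) := by
  set c : Fin d → ℝ := fun a => if P a then 1 else 0 with hc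
  have hc0 : ∀ a, 0 ≤ c a := fun a => by simp only [hc]; split_ifs <;> norm_num
  have hc1 : ∀ a, c a ≤ 1 := fun a => by simp only [hc]; split_ifs <;> norm_num
  have hid := main_identity μ hinv v hv c hc0 hc1 s hs
  have hprod : ∏ a, Real.pi / (1 - s * c a) = Real.pi ^ d * ((1 - s)⁻¹) ^ k := by
    have : ∀ a, Real.pi / (1 - s * c a) = Real.pi * (if P a then (1 - s)⁻¹ else 1) := by
      intro a
      simp only [hc]
      split_ifs <;> simp [div_eq_mul_inv]
    simp_rw [this]
    rw [Finset.prod_mul_distrib, Finset.prod_ite]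
    simp [hk]
  have hpi : (0:ℝ) < Real.pi ^ d := by positivity
  have hpi0 : ENNReal.ofReal (Real.pi ^ d) ≠ 0 := by simpa using hpi
  rw [hprod, ENNReal.ofReal_mul hpi.le] at hid
  rw [← ENNReal.mul_le_mul_iff_right hpi0 ENNReal.ofReal_ne_top, ← hid,
    ← lintegral_const_mul' _ _ ENNReal.ofReal_ne_top]
  refine lintegral_mono fun U => ?_
  simp only
  rw [← ENNReal.ofReal_mul hpi.le]
  apply ENNReal.ofReal_le_ofReal
  set w := (U : Matrix (Fin d) (Fin d) ℂ).mulVec v with hw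
  have hw1 : nsq w = 1 := by rw [hw, nsq_unitary, hv]
  have hq0 : 0 ≤ qsq c w := Finset.sum_nonneg fun a _ => mul_nonneg (hc0 a) (by positivity)
  have hq1 : qsq c w ≤ 1 := by
    rw [← hw1]
    exact Finset.sum_le_sum fun a _ => mul_le_of_le_one_left (by positivity) (hc1 a)
  have hp : 0 < 1 - s * qsq c w := aux_pos _ _ hs hq0 hq1
  rw [div_pow, div_eq_mul_inv]
  refine mul_le_mul_of_nonneg_left ?_ hpi.le
  rw [mul_assoc, Real.exp_nat_mul, ← inv_pow]
  refine pow_le_pow_left₀ (Real.exp_pos _).le ?_ d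
  rw [le_inv_comm₀ (Real.exp_pos _) hp, ← Real.exp_neg]
  have := Real.add_one_le_exp (-(s * qsq c w))
  linarith

lemma tail_bound {d k : ℕ} (hd : 0 < d) (μ : Measure (Matrix.unitaryGroup (Fin d) ℂ)) [IsProbabilityMeasure μ]
    (hinv : ∀ V : Matrix.unitaryGroup (Fin d) ℂ, μ.map (fun U => V * U) = μ)
    (v : Fin d → ℂ) (hv : nsq v = 1) (P : Fin d → Prop) [DecidablePred P]
    (hk : (Finset.univ.filter P).card = k)
    (δ : ℝ) (hδ : -1 < δ) :
    μ {U : Matrix.unitaryGroup (Fin d) ℂ | 0 ≤ (1 - ((1 + δ) ^ 2)⁻¹) *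
      (qsq (fun a => if P a then 1 else 0) ((U : Matrix (Fin d) (Fin d) ℂ).mulVec v)
        - (1 + δ) ^ 2 * (k / d))} ≤ ENNReal.ofReal (Real.exp (-(δ ^ 2 * k))) := by
  have h1 : 0 < 1 + δ := by linarith
  have h2 : 0 < (1 + δ) ^ 2 := by positivity
  set s := 1 - ((1 + δ) ^ 2)⁻¹ with hs
  have hs1 : s < 1 := by
    have : 0 < ((1 + δ) ^ 2)⁻¹ := by positivity
    linarith
  have hm := mgf_bound μ hinv v hv P hk s hs1
  set q : Matrix.unitaryGroup (Fin d) ℂ → ℝ := fun U =>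
    qsq (fun a => if P a then 1 else 0) ((U : Matrix (Fin d) (Fin d) ℂ).mulVec v) with hq
  have hqm : Measurable q := (meas_qsq _).comp
    (meas_mulVec.comp (measurable_subtype_coe.prodMk measurable_const))
  have hds : (1 + δ) ^ 2 * s = (1 + δ) ^ 2 - 1 := by
    rw [hs]
    field_simp
  have hd' : (0:ℝ) < d := by exact_mod_cast hd
  have hsub : {U | 0 ≤ s * (q U - (1 + δ) ^ 2 * (k / d))} ⊆
      {U | ENNReal.ofReal (Real.exp (((1 + δ) ^ 2 - 1) * k)) ≤
        ENNReal.ofReal (Real.exp (d * s * q U))} := by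
    intro U hU
    simp only [Set.mem_ofPred_eq] at hU ⊢
    apply ENNReal.ofReal_le_ofReal
    apply Real.exp_le_exp.2
    have h3 : 0 ≤ d * (s * (q U - (1 + δ) ^ 2 * (k / d))) := mul_nonneg hd'.le hU
    have h4 : d * (s * (q U - (1 + δ) ^ 2 * (k / d))) = d * s * q U - ((1 + δ) ^ 2 * s) * k := by
      field_simp
    rw [h4, hds] at h3
    linarith
  refine (measure_mono hsub).trans ?_
  have hmark := mul_meas_ge_le_lintegral (μ := μ)
    (f := fun U => ENNReal.ofReal (Real.exp (d * s * q U))) (by fun_prop)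
    (ENNReal.ofReal (Real.exp (((1 + δ) ^ 2 - 1) * k)))
  have hA : ENNReal.ofReal (Real.exp (((1 + δ) ^ 2 - 1) * k)) ≠ 0 := by
    simpa using Real.exp_pos _
  rw [← ENNReal.mul_le_mul_iff_right hA ENNReal.ofReal_ne_top]
  refine hmark.trans (hm.trans ?_)
  rw [← ENNReal.ofReal_mul (Real.exp_pos _).le]
  apply ENNReal.ofReal_le_ofReal
  have h5 : (1 - s)⁻¹ = (1 + δ) ^ 2 := by
    rw [hs]
    simp
  rw [h5, ← Real.exp_add]
  have h6 : (1 + δ) ^ 2 ≤ Real.exp (2 * δ) := by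
    have := Real.add_one_le_exp δ
    calc (1 + δ) ^ 2 ≤ (Real.exp δ) ^ 2 := pow_le_pow_left₀ h1.le (by linarith) 2
      _ = Real.exp (2 * δ) := by rw [← Real.exp_nat_mul]; norm_num
  calc ((1 + δ) ^ 2) ^ k ≤ (Real.exp (2 * δ)) ^ k := pow_le_pow_left₀ h2.le h6 k
    _ = Real.exp (k * (2 * δ)) := by rw [← Real.exp_nat_mul]
    _ = _ := by congr 1; ring

lemma card_block (d1 d2 i : ℕ) (h2 : 0 < d2) (hi : i < d1 / d2) :
    (Finset.univ.filter (fun a : Fin d1 => a.val / d2 = i)).card = d2 := by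
  have hle : i * d2 + d2 ≤ d1 := by
    have := Nat.mul_le_of_le_div d2 (i + 1) d1 hi
    linarith
  have : (Finset.univ.filter (fun a : Fin d1 => a.val / d2 = i)).map Fin.valEmbedding
      = Finset.Ico (i * d2) (i * d2 + d2) := by
    ext x
    simp only [Finset.mem_map, Finset.mem_filter, Finset.mem_univ, true_and, Fin.valEmbedding_apply,
      Finset.mem_Ico]
    constructor
    · rintro ⟨a, ha, rfl⟩
      rw [Nat.div_eq_iff h2] at ha
      omega
    · intro hx
      refine ⟨⟨x, by omega⟩, ?_, rfl⟩
      rw [Nat.div_eq_iff h2]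
      simp only
      omega
  rw [← Finset.card_map Fin.valEmbedding, this]
  simp

/-- **Concentration of the projection of a Haar-random rotation of a unit vector.**
For a fixed unit vector `v ∈ ℂ^{d₁}`, a block of `d₂` coordinates (`d₂ ∣ d₁`, `d₂ < d₁`),
and a Haar-random unitary `U` (here: any left-translation-invariant probability measure on
the unitary group), the probability that `‖Π_i U v‖₂ ∉ [(1-ε)√(d₂/d₁), (1+ε)√(d₂/d₁)]`
is at most `4 exp(-ε² d₂ / 2⁴)`. -/
theorem haar_projection_concentration
    (d1 d2 : ℕ) (hd : d2 < d1) (hdvd : d2 ∣ d1)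
    (v : Fin d1 → ℂ) (hv : l2norm v = 1)
    (i : ℕ) (hi : i < d1 / d2)
    (ε : ℝ) (hε : 0 < ε)
    (μ : Measure (Matrix.unitaryGroup (Fin d1) ℂ)) [IsProbabilityMeasure μ]
    (hinv : ∀ V : Matrix.unitaryGroup (Fin d1) ℂ, μ.map (fun U => V * U) = μ) :
    μ {U : Matrix.unitaryGroup (Fin d1) ℂ |
        ¬((1 - ε) * Real.sqrt ((d2 : ℝ) / d1)
            ≤ l2norm ((blockProj d1 d2 i).mulVec ((U : Matrix (Fin d1) (Fin d1) ℂ).mulVec v)) ∧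
          l2norm ((blockProj d1 d2 i).mulVec ((U : Matrix (Fin d1) (Fin d1) ℂ).mulVec v))
            ≤ (1 + ε) * Real.sqrt ((d2 : ℝ) / d1))}
      ≤ ENNReal.ofReal (4 * Real.exp (-(ε ^ 2 * d2) / 2 ^ 4)) := by
  have h2 : 0 < d2 := by
    rcases Nat.eq_zero_or_pos d2 with h | h
    · subst h
      simp at hi
    · exact h
  have h1 : 0 < d1 := by omega
  have hv' : nsq v = 1 := by
    unfold l2norm at hv
    exact Real.sqrt_eq_one.1 hv
  have hcard := card_block d1 d2 i h2 hi
  set q : Matrix.unitaryGroup (Fin d1) ℂ → ℝ := fun U =>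
    qsq (fun a : Fin d1 => if a.val / d2 = i then 1 else 0)
      ((U : Matrix (Fin d1) (Fin d1) ℂ).mulVec v) with hq
  have hl : ∀ U : Matrix.unitaryGroup (Fin d1) ℂ,
      l2norm ((blockProj d1 d2 i).mulVec ((U : Matrix (Fin d1) (Fin d1) ℂ).mulVec v))
        = Real.sqrt (q U) := by
    intro U
    simp only [l2norm, hq, qsq, blockProj, Matrix.mulVec_diagonal]
    congr 1
    refine Finset.sum_congr rfl fun a _ => ?_
    split_ifs <;> simp
  have hq0 : ∀ U, 0 ≤ q U := fun U => Finset.sum_nonneg fun a _ => by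
    dsimp only
    split_ifs <;> simp
  simp_rw [hl]
  have hp0 : (0:ℝ) ≤ (d2 : ℝ) / d1 := by positivity
  have hup := tail_bound h1 μ hinv v hv' (fun a : Fin d1 => a.val / d2 = i) hcard ε (by linarith)
  have hlow : μ {U | Real.sqrt (q U) < (1 - ε) * Real.sqrt ((d2 : ℝ) / d1)} ≤
      ENNReal.ofReal (Real.exp (-(ε ^ 2 * d2))) := by
    by_cases hε1 : ε < 1
    · have := tail_bound h1 μ hinv v hv' (fun a : Fin d1 => a.val / d2 = i) hcard (-ε) (by linarith)
      rw [neg_sq] at this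
      refine (measure_mono ?_).trans this
      intro U hU
      simp only [Set.mem_ofPred_eq] at hU ⊢
      have hlt : q U < (1 + -ε) ^ 2 * (d2 / d1) := by
        have := (Real.sqrt_lt' (lt_of_le_of_lt (Real.sqrt_nonneg _) hU)).1 hU
        rw [mul_pow, Real.sq_sqrt hp0] at this
        exact this
      apply mul_nonneg_of_nonpos_of_nonpos
      · have : 1 ≤ ((1 + -ε) ^ 2)⁻¹ := (one_le_inv₀ (by nlinarith)).2 (by nlinarith)
        linarith
      · exact (sub_neg.2 hlt).le
    · have : {U | Real.sqrt (q U) < (1 - ε) * Real.sqrt ((d2 : ℝ) / d1)} = ∅ := by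
        ext U
        simp only [Set.mem_ofPred_eq, Set.mem_empty_iff_false, iff_false, not_lt]
        refine le_trans ?_ (Real.sqrt_nonneg _)
        exact mul_nonpos_of_nonpos_of_nonneg (by linarith) (Real.sqrt_nonneg _)
      rw [this]
      simp
  have hup' : μ {U | (1 + ε) * Real.sqrt ((d2 : ℝ) / d1) < Real.sqrt (q U)} ≤
      ENNReal.ofReal (Real.exp (-(ε ^ 2 * d2))) := by
    refine (measure_mono ?_).trans hup
    intro U hU
    simp only [Set.mem_ofPred_eq] at hU ⊢
    have hlt : (1 + ε) ^ 2 * (d2 / d1) < q U := by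
      have := (Real.lt_sqrt (by positivity)).1 hU
      rw [mul_pow, Real.sq_sqrt hp0] at this
      exact this
    apply mul_nonneg
    · have : ((1 + ε) ^ 2)⁻¹ ≤ 1 := inv_le_one_of_one_le₀ (by nlinarith)
      linarith
    · exact (sub_pos.2 hlt).le
  have hsub : {U : Matrix.unitaryGroup (Fin d1) ℂ | ¬((1 - ε) * Real.sqrt ((d2 : ℝ) / d1) ≤ Real.sqrt (q U) ∧
      Real.sqrt (q U) ≤ (1 + ε) * Real.sqrt ((d2 : ℝ) / d1))} ⊆
      {U | Real.sqrt (q U) < (1 - ε) * Real.sqrt ((d2 : ℝ) / d1)} ∪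
      {U | (1 + ε) * Real.sqrt ((d2 : ℝ) / d1) < Real.sqrt (q U)} := by
    intro U hU
    simp only [Set.mem_ofPred_eq, Set.mem_union] at hU ⊢
    rw [not_and_or, not_le, not_le] at hU
    exact hU
  refine (measure_mono hsub).trans ((measure_union_le _ _).trans ((add_le_add hlow hup').trans ?_))
  rw [← ENNReal.ofReal_add (Real.exp_pos _).le (Real.exp_pos _).le]
  apply ENNReal.ofReal_le_ofReal
  have hx : 0 ≤ ε ^ 2 * (d2 : ℝ) := by positivity
  have he : Real.exp (-(ε ^ 2 * d2)) ≤ Real.exp (-(ε ^ 2 * d2) / 2 ^ 4) :=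
    Real.exp_le_exp.2 (by linarith)
  have := Real.exp_pos (-(ε ^ 2 * (d2 : ℝ)) / 2 ^ 4)
  linarith
end
end

section
/- Let $v \in \mathbb{C}^{d_1}$ with $\|v\|_2 = 1$, let $d_2 < d_1$ with $d_2$ dividing $d_1$, fix a block index $i$ with $1 \leq i \leq d_1/d_2$, and let $\epsilon > 0$. Then for a Haar random $d_1 \times d_1$ unitary matrix $U$, $\Pr_U\left[\|\Pi_i U v\|_2 > (1+\epsilon)\sqrt{d_2/d_1}\right] \leq 2 \exp(-2^{-2}\epsilon^2 d_2)$. -/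
open MeasureTheory Matrix

noncomputable section

section group

variable {G : Type*} [Group G] [MeasurableSpace G] (μ : Measure G)

lemma left_inv_aux (hmul : Measurable fun p : G × G => p.1 * p.2)
    (hinv : ∀ V : G, μ.map (fun U => V * U) = μ)
    (V : G) {T : Set G} (hT : MeasurableSet T) : μ {U | V * U ∈ T} = μ T := by
  have hm : Measurable fun U : G => V * U := hmul.comp (measurable_const.prodMk measurable_id)
  conv_rhs => rw [← hinv V, Measure.map_apply hm hT]
  rfl

lemma inv_inv_aux [IsProbabilityMeasure μ] (hmul : Measurable fun p : G × G => p.1 * p.2)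
    (hi : Measurable fun p : G => p⁻¹)
    (hinv : ∀ V : G, μ.map (fun U => V * U) = μ)
    {T : Set G} (hT : MeasurableSet T) : μ T = μ {W | W⁻¹ ∈ T} := by
  have hm : Measurable fun p : G × G => p.1⁻¹ * p.2 :=
    hmul.comp ((hi.comp measurable_fst).prodMk measurable_snd)
  have hS : MeasurableSet {p : G × G | p.1⁻¹ * p.2 ∈ T} := hm hT
  have e1 := Measure.prod_apply (μ := μ) (ν := μ) hS
  have e2 := Measure.prod_apply_symm (μ := μ) (ν := μ) hS
  have f1 : ∀ W : G, μ (Prod.mk W ⁻¹' {p : G × G | p.1⁻¹ * p.2 ∈ T}) = μ T :=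
    fun W => left_inv_aux μ hmul hinv W⁻¹ hT
  have f2 : ∀ U : G, μ ((fun W => (W, U)) ⁻¹' {p : G × G | p.1⁻¹ * p.2 ∈ T}) =
      μ {W | W⁻¹ ∈ T} := by
    intro U
    have hm2 : MeasurableSet {W : G | W⁻¹ * U ∈ T} :=
      (hmul.comp (hi.prodMk measurable_const)) hT
    have := left_inv_aux μ hmul hinv U hm2
    refine Eq.trans this.symm ?_
    congr 1
    ext W
    simp
  rw [lintegral_congr f1] at e1
  rw [lintegral_congr f2] at e2
  rw [e1] at e2
  simpa using e2

lemma right_inv_aux [IsProbabilityMeasure μ] (hmul : Measurable fun p : G × G => p.1 * p.2)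
    (hi : Measurable fun p : G => p⁻¹)
    (hinv : ∀ V : G, μ.map (fun U => V * U) = μ)
    (S : G) {T : Set G} (hT : MeasurableSet T) : μ {U | U * S ∈ T} = μ T := by
  have h1 : MeasurableSet {U : G | U * S ∈ T} :=
    (hmul.comp (measurable_id.prodMk measurable_const)) hT
  have hTi : MeasurableSet {W : G | W⁻¹ ∈ T} := hi hT
  rw [inv_inv_aux μ hmul hi hinv h1, inv_inv_aux μ hmul hi hinv hT,
    ← left_inv_aux μ hmul hinv S⁻¹ hTi]
  congr 1
  ext W
  simp

end group

section helpers

variable {n : ℕ}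

lemma meas_of_entries {α : Type*} [MeasurableSpace α] {f : α → Matrix.unitaryGroup (Fin n) ℂ}
    (h : ∀ a b, Measurable fun x => (f x : Matrix (Fin n) (Fin n) ℂ) a b) : Measurable f := by
  have h2 : Measurable fun x => (f x : Matrix (Fin n) (Fin n) ℂ) := by
    refine measurable_pi_iff.2 fun a => ?_
    refine measurable_pi_iff.2 fun b => ?_
    exact h a b
  exact h2.subtype_mk (h := fun x => (f x).2)

lemma meas_entry (a b : Fin n) :
    Measurable fun U : Matrix.unitaryGroup (Fin n) ℂ => (U : Matrix (Fin n) (Fin n) ℂ) a b := by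
  have h2 : Measurable fun U : Matrix.unitaryGroup (Fin n) ℂ =>
      (U : Matrix (Fin n) (Fin n) ℂ) := measurable_subtype_coe
  exact (measurable_pi_iff.1 ((measurable_pi_iff.1 h2) a)) b

lemma meas_mul : Measurable fun p : Matrix.unitaryGroup (Fin n) ℂ × Matrix.unitaryGroup (Fin n) ℂ =>
    p.1 * p.2 := by
  refine meas_of_entries fun a b => ?_
  simp only [Matrix.UnitaryGroup.mul_val, Matrix.mul_apply]
  exact Finset.measurable_sum _ fun c _ =>
    ((meas_entry a c).comp measurable_fst).mul ((meas_entry c b).comp measurable_snd)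

lemma meas_inv : Measurable fun p : Matrix.unitaryGroup (Fin n) ℂ => p⁻¹ := by
  refine meas_of_entries fun a b => ?_
  simp only [Matrix.UnitaryGroup.inv_val, Matrix.star_apply]
  exact (Complex.continuous_conj.measurable).comp (meas_entry b a)

variable (μ : Measure (Matrix.unitaryGroup (Fin n) ℂ)) [IsProbabilityMeasure μ]

lemma exists_col (v : EuclideanSpace ℂ (Fin n)) (hv : ‖v‖ = 1) (j : Fin n) :
    ∃ P : Matrix.unitaryGroup (Fin n) ℂ, ∀ a, (P : Matrix (Fin n) (Fin n) ℂ) a j = v a := by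
  have ho : Orthonormal ℂ (({j} : Set (Fin n)).domRestrict (fun _ : Fin n => v)) := by
    rw [orthonormal_iff_ite]
    rintro ⟨a, ha⟩ ⟨b, hb⟩
    simp only [Set.mem_singleton_iff] at ha hb
    subst ha; subst hb
    simp [Set.domRestrict, hv]
  obtain ⟨b, hb⟩ := ho.exists_orthonormalBasis_extension_of_card_eq (by simp)
  refine ⟨⟨Matrix.of fun a c => b c a, ?_⟩, fun a => ?_⟩
  · rw [Matrix.mem_unitaryGroup_iff']
    ext c d
    have := orthonormal_iff_ite.1 b.orthonormal c d
    rw [PiLp.inner_apply] at this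
    simp only [Matrix.mul_apply, Matrix.star_apply, Matrix.one_apply, Matrix.of_apply]
    rw [← this]
    refine Finset.sum_congr rfl fun a _ => ?_
    simp [mul_comm]
  · have := hb j rfl
    simp [this]

lemma exists_rot (v w : Fin n → ℂ) (hv : ∑ a, ‖v a‖ ^ 2 = 1) (hw : ∑ a, ‖w a‖ ^ 2 = 1) :
    ∃ S : Matrix.unitaryGroup (Fin n) ℂ, (S : Matrix (Fin n) (Fin n) ℂ).mulVec v = w := by
  rcases Nat.eq_zero_or_pos n with h | h
  · subst h; simp at hv
  let j : Fin n := ⟨0, h⟩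
  obtain ⟨P, hP⟩ := exists_col (WithLp.toLp 2 v) (by rw [EuclideanSpace.norm_eq]; simp [hv]) j
  obtain ⟨Q, hQ⟩ := exists_col (WithLp.toLp 2 w) (by rw [EuclideanSpace.norm_eq]; simp [hw]) j
  have hP' : (P : Matrix (Fin n) (Fin n) ℂ).mulVec (Pi.single j 1) = v := by
    ext a; simp [hP]
  have hQ' : (Q : Matrix (Fin n) (Fin n) ℂ).mulVec (Pi.single j 1) = w := by
    ext a; simp [hQ]
  refine ⟨Q * P⁻¹, ?_⟩
  have h1 : ((Q * P⁻¹ : Matrix.unitaryGroup (Fin n) ℂ) : Matrix (Fin n) (Fin n) ℂ) *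
      (P : Matrix (Fin n) (Fin n) ℂ) = Q := by
    rw [← Matrix.UnitaryGroup.mul_val]; simp
  rw [← hP', Matrix.mulVec_mulVec, h1, hQ']

lemma vol_pres (U : Matrix.unitaryGroup (Fin n) ℂ) :
    MeasurePreserving (fun x : Fin n → ℂ => (U : Matrix (Fin n) (Fin n) ℂ).mulVec x) := by
  let f : (Fin n → ℂ) →ₗ[ℂ] (Fin n → ℂ) := Matrix.toLin' (U : Matrix (Fin n) (Fin n) ℂ)
  have hd : ‖LinearMap.det f‖ = 1 := by
    have : LinearMap.det f ∈ unitary ℂ := by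
      simp only [f, LinearMap.det_toLin']
      exact Matrix.det_of_mem_unitary U.2
    exact CStarRing.norm_of_mem_unitary this
  have hdR : LinearMap.det (f.restrictScalars ℝ) = 1 := by
    rw [LinearMap.det_restrictScalars, Algebra.norm_complex_apply, Complex.normSq_eq_norm_sq, hd]
    simp
  refine ⟨?_, ?_⟩
  · exact (LinearMap.continuous_of_finiteDimensional f).measurable
  · have := Measure.map_linearMap_addHaar_eq_smul_addHaar
      (volume : Measure (Fin n → ℂ)) (f := f.restrictScalars ℝ) (by rw [hdR]; simp)
    rw [hdR] at this
    simp only [inv_one, abs_one, ENNReal.ofReal_one, one_smul] at this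
    exact this

lemma gauss (c : Fin n → ℝ) (hc : ∀ a, 0 < c a) :
    ∫⁻ x : Fin n → ℂ, ENNReal.ofReal (Real.exp (-∑ a, c a * ‖x a‖ ^ 2)) =
      ENNReal.ofReal (∏ a, (Real.pi / c a)) := by
  have h1 : ∀ a, ∫ z : ℂ, Real.exp (-(c a * ‖z‖ ^ 2)) = Real.pi / c a := by
    intro a
    have := Complex.integral_exp_neg_mul_rpow (p := 2) (by norm_num) (hc a)
    norm_num at this
    rw [Real.rpow_neg_one] at this
    simpa [div_eq_mul_inv] using this
  have hI : ∀ a, Integrable fun z : ℂ => Real.exp (-(c a * ‖z‖ ^ 2)) := by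
    intro a
    by_contra h
    have h2 := h1 a
    rw [integral_undef h] at h2
    have := div_pos Real.pi_pos (hc a)
    linarith
  have hI2 := Integrable.fintype_prod (μ := fun _ : Fin n => (volume : Measure ℂ)) hI
  have h3 := integral_fintype_prod_volume_eq_prod
    (fun (a : Fin n) (z : ℂ) => Real.exp (-(c a * ‖z‖ ^ 2)))
  simp only [h1] at h3
  rw [← h3, ofReal_integral_eq_lintegral_ofReal]
  · refine lintegral_congr fun x => ?_
    rw [← Real.exp_sum, Finset.sum_neg_distrib]
  · exact hI2
  · exact Filter.Eventually.of_forall fun x => by positivity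

lemma norm_pres (U : Matrix.unitaryGroup (Fin n) ℂ) (x : Fin n → ℂ) :
    ∑ a, ‖(U : Matrix (Fin n) (Fin n) ℂ).mulVec x a‖ ^ 2 = ∑ a, ‖x a‖ ^ 2 := by
  have key : ∀ y : Fin n → ℂ, ((∑ a, ‖y a‖ ^ 2 : ℝ) : ℂ) = star y ⬝ᵥ y := by
    intro y
    simp only [dotProduct, Pi.star_apply]
    push_cast
    refine Finset.sum_congr rfl fun a _ => ?_
    exact (Complex.conj_mul' (y a)).symm
  have : ((∑ a, ‖(U : Matrix (Fin n) (Fin n) ℂ).mulVec x a‖ ^ 2 : ℝ) : ℂ)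
      = ((∑ a, ‖x a‖ ^ 2 : ℝ) : ℂ) := by
    rw [key, key, Matrix.star_mulVec, Matrix.dotProduct_mulVec, Matrix.vecMul_vecMul,
      ← Matrix.star_eq_conjTranspose, Matrix.mem_unitaryGroup_iff'.1 U.2, Matrix.vecMul_one]
  exact_mod_cast this

lemma meas_act : Measurable fun p : Matrix.unitaryGroup (Fin n) ℂ × (Fin n → ℂ) =>
    (p.1 : Matrix (Fin n) (Fin n) ℂ).mulVec p.2 := by
  refine measurable_pi_iff.2 fun a => ?_
  simp only [Matrix.mulVec, dotProduct]
  exact Finset.measurable_sum _ fun c _ =>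
    ((meas_entry a c).comp measurable_fst).mul ((measurable_pi_apply c).comp measurable_snd)

/-- A measurable cone has the same mass under the Haar orbit and under the Gaussian. -/
lemma cone_mass (hn : 0 < n)
    (hinv : ∀ V : Matrix.unitaryGroup (Fin n) ℂ, μ.map (fun U => V * U) = μ)
    (v : Fin n → ℂ) (hv : ∑ a, ‖v a‖ ^ 2 = 1) (A : Set (Fin n → ℂ)) (hA : MeasurableSet A)
    (hcone : ∀ (r : ℝ) (x : Fin n → ℂ), 0 < r → x ∈ A → (fun a => (r : ℂ) * x a) ∈ A) :
    μ {U | (U : Matrix (Fin n) (Fin n) ℂ).mulVec v ∈ A} *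
      (∫⁻ x : Fin n → ℂ, ENNReal.ofReal (Real.exp (-∑ a, ‖x a‖ ^ 2))) ≤
      ∫⁻ x : Fin n → ℂ, A.indicator (fun x => ENNReal.ofReal (Real.exp (-∑ a, ‖x a‖ ^ 2))) x := by
  set F : (Fin n → ℂ) → ENNReal := fun x => ENNReal.ofReal (Real.exp (-∑ a, ‖x a‖ ^ 2)) with hF
  have hFm : Measurable F := by
    have : Continuous fun x : Fin n → ℂ => Real.exp (-∑ a, ‖x a‖ ^ 2) := by fun_prop
    exact this.measurable.ennreal_ofReal
  have hFA : Measurable (A.indicator F) := hFm.indicator hA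
  have hact : ∀ x : Fin n → ℂ, Measurable fun U : Matrix.unitaryGroup (Fin n) ℂ =>
      (U : Matrix (Fin n) (Fin n) ℂ).mulVec x := fun x =>
    meas_act.comp (measurable_id.prodMk measurable_const)
  have s1 : ∫⁻ x, A.indicator F x =
      ∫⁻ U : Matrix.unitaryGroup (Fin n) ℂ, (∫⁻ x : Fin n → ℂ,
        A.indicator F ((U : Matrix (Fin n) (Fin n) ℂ).mulVec x)) ∂μ := by
    simp_rw [fun U : Matrix.unitaryGroup (Fin n) ℂ => (vol_pres U).lintegral_comp hFA]
    simp
  rw [s1, lintegral_lintegral_swap (f := fun (U : Matrix.unitaryGroup (Fin n) ℂ) (x : Fin n → ℂ) =>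
    A.indicator F ((U : Matrix (Fin n) (Fin n) ℂ).mulVec x)) (hFA.comp meas_act).aemeasurable, ← lintegral_const_mul _ hFm]
  have hne : ∀ᵐ x : Fin n → ℂ, x ≠ 0 := by
    have : Nonempty (Fin n) := ⟨⟨0, hn⟩⟩
    exact Measure.ae_ne volume 0
  refine lintegral_mono_ae ?_
  filter_upwards [hne] with x hx
  have hFU : ∀ U : Matrix.unitaryGroup (Fin n) ℂ,
      F ((U : Matrix (Fin n) (Fin n) ℂ).mulVec x) = F x := by
    intro U; simp only [hF, norm_pres]
  have e : ∀ U : Matrix.unitaryGroup (Fin n) ℂ,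
      A.indicator F ((U : Matrix (Fin n) (Fin n) ℂ).mulVec x) =
      ({U | (U : Matrix (Fin n) (Fin n) ℂ).mulVec x ∈ A} :
        Set (Matrix.unitaryGroup (Fin n) ℂ)).indicator (fun _ => F x) U := by
    intro U
    by_cases hU : (U : Matrix (Fin n) (Fin n) ℂ).mulVec x ∈ A
    · rw [Set.indicator_of_mem hU, hFU]
      exact (Set.indicator_of_mem (s := {U : Matrix.unitaryGroup (Fin n) ℂ |
        (U : Matrix (Fin n) (Fin n) ℂ).mulVec x ∈ A}) hU (fun _ => F x)).symm
    · rw [Set.indicator_of_notMem hU]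
      exact (Set.indicator_of_notMem (s := {U : Matrix.unitaryGroup (Fin n) ℂ |
        (U : Matrix (Fin n) (Fin n) ℂ).mulVec x ∈ A}) hU (fun _ => F x)).symm
  simp_rw [e]
  have hms : MeasurableSet {U : Matrix.unitaryGroup (Fin n) ℂ |
      (U : Matrix (Fin n) (Fin n) ℂ).mulVec x ∈ A} := hact x hA
  rw [lintegral_indicator_const hms, mul_comm]
  gcongr _ * ?_
  -- rotate
  have hpos : 0 < ∑ a, ‖x a‖ ^ 2 := by
    obtain ⟨a, ha⟩ := Function.ne_iff.1 hx
    refine Finset.sum_pos' (fun _ _ => by positivity) ⟨a, Finset.mem_univ _, ?_⟩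
    have : 0 < ‖x a‖ := norm_pos_iff.2 ha
    positivity
  set r := Real.sqrt (∑ a, ‖x a‖ ^ 2) with hr
  have hr0 : 0 < r := Real.sqrt_pos.2 hpos
  have hr2 : r ^ 2 = ∑ a, ‖x a‖ ^ 2 := Real.sq_sqrt hpos.le
  obtain ⟨S, hS⟩ := exists_rot v (fun a => ((r⁻¹ : ℝ) : ℂ) * x a) hv (by
    simp only [norm_mul, mul_pow, ← Finset.mul_sum, ← hr2, Complex.norm_real]
    simp only [norm_inv, Real.norm_eq_abs, inv_pow, sq_abs]
    field_simp)
  have hx' : x = fun a => (r : ℂ) * ((S : Matrix (Fin n) (Fin n) ℂ).mulVec v) a := by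
    rw [hS]; ext a
    push_cast
    rw [← mul_assoc, mul_inv_cancel₀ (by exact_mod_cast hr0.ne'), one_mul]
  rw [← right_inv_aux μ meas_mul meas_inv hinv S (T := {U | (U : Matrix (Fin n) (Fin n) ℂ).mulVec v ∈ A}) (hact v hA)]
  refine measure_mono fun U hU => ?_
  simp only [Set.mem_ofPred_eq, Matrix.UnitaryGroup.mul_val, ← Matrix.mulVec_mulVec] at hU ⊢
  have := hcone r _ hr0 hU
  convert this using 1
  have h4 : x = (r : ℂ) • ((S : Matrix (Fin n) (Fin n) ℂ).mulVec v) := hx'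
  conv_lhs => rw [h4, Matrix.mulVec_smul]
  rfl

lemma block_card (d1 d2 i : ℕ) (hd2 : 0 < d2) (hi : i < d1 / d2) :
    (Finset.univ.filter fun a : Fin d1 => a.val / d2 = i).card = d2 := by
  have hle : i * d2 + d2 ≤ d1 := by
    have := Nat.mul_le_of_le_div d2 (i + 1) d1 hi
    linarith [add_mul i 1 d2]
  have : (Finset.univ.filter fun a : Fin d1 => a.val / d2 = i).map Fin.valEmbedding =
      Finset.Ico (i * d2) (i * d2 + d2) := by
    ext m
    simp only [Finset.mem_map, Finset.mem_filter, Finset.mem_univ, true_and, Fin.valEmbedding_apply,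
      Finset.mem_Ico]
    have hdv : m / d2 = i ↔ i * d2 ≤ m ∧ m < i * d2 + d2 := by
      rw [Nat.div_eq_iff hd2]
      omega
    constructor
    · rintro ⟨a, h, rfl⟩
      exact hdv.1 h
    · intro h
      exact ⟨⟨m, by omega⟩, hdv.2 h, rfl⟩
  rw [← Finset.card_map Fin.valEmbedding, this]
  simp

lemma scalar_bound (k m : ℕ) (n ε : ℝ) (hn : n = k + m) (hk : 0 < k) (hm : 0 < m)
    (hε : 0 < ε) (h : (1 + ε) ^ 2 * k < n) :
    ((1 + ε) ^ 2) ^ k * ((n - (1 + ε) ^ 2 * k) / (n - k)) ^ m ≤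
      2 * Real.exp (-(ε ^ 2 * k) / 2 ^ 2) := by
  have hm' : (0 : ℝ) < m := by exact_mod_cast hm
  have hk' : (0 : ℝ) < k := by exact_mod_cast hk
  have hnk : n - k = m := by linarith
  rw [hnk]
  have h1 : ((1 + ε) ^ 2) ^ k ≤ Real.exp (2 * ε * k) := by
    have : Real.exp (2 * ε * k) = (Real.exp ε ^ 2) ^ k := by
      rw [← Real.exp_nat_mul, ← Real.exp_nat_mul]; congr 1; push_cast; ring
    rw [this]
    gcongr
    linarith [Real.add_one_le_exp ε]
  have h2 : ((n - (1 + ε) ^ 2 * k) / m) ^ m ≤ Real.exp (-(2 * ε + ε ^ 2) * k) := by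
    have e : Real.exp (-(2 * ε + ε ^ 2) * k) = Real.exp (-(2 * ε + ε ^ 2) * k / m) ^ m := by
      rw [← Real.exp_nat_mul]; congr 1; field_simp
    rw [e]
    have h3 : (n - (1 + ε) ^ 2 * k) / m = -(2 * ε + ε ^ 2) * k / m + 1 := by
      rw [hn]; field_simp; ring
    refine pow_le_pow_left₀ (div_nonneg (by linarith) hm'.le) ?_ _
    rw [h3]
    exact Real.add_one_le_exp _
  calc _ ≤ Real.exp (2 * ε * k) * Real.exp (-(2 * ε + ε ^ 2) * k) := by
        refine mul_le_mul h1 h2 (pow_nonneg (div_nonneg (by linarith) hm'.le) _) (by positivity)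
    _ = Real.exp (-(ε ^ 2 * k)) := by rw [← Real.exp_add]; congr 1; ring
    _ ≤ Real.exp (-(ε ^ 2 * k) / 2 ^ 2) := by
        apply Real.exp_le_exp.2
        have : 0 ≤ ε ^ 2 * k := by positivity
        linarith
    _ ≤ _ := by linarith [Real.exp_pos (-(ε ^ 2 * k) / 2 ^ 2)]

end helpers

/-- **Upper tail bound for the projected norm of a Haar-random rotation:** for a fixed unit
vector `v ∈ ℂ^{d₁}`, a fixed block of `d₂` coordinates and any `ε > 0`,
`Pr_U[‖Π_i U v‖₂ > (1+ε)√(d₂/d₁)] ≤ 2 exp(-ε² d₂ / 2²)` under the Haar probability measure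
(here: any left-translation-invariant probability measure on the unitary group). -/
theorem haar_projection_upper_tail
    (d1 d2 : ℕ) (hd : d2 < d1) (hdvd : d2 ∣ d1)
    (v : Fin d1 → ℂ) (hv : l2norm v = 1)
    (i : ℕ) (hi : i < d1 / d2)
    (ε : ℝ) (hε : 0 < ε)
    (μ : Measure (Matrix.unitaryGroup (Fin d1) ℂ)) [IsProbabilityMeasure μ]
    (hinv : ∀ V : Matrix.unitaryGroup (Fin d1) ℂ, μ.map (fun U => V * U) = μ) :
    μ {U : Matrix.unitaryGroup (Fin d1) ℂ |
        (1 + ε) * Real.sqrt ((d2 : ℝ) / d1)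
          < l2norm ((blockProj d1 d2 i).mulVec ((U : Matrix (Fin d1) (Fin d1) ℂ).mulVec v))}
      ≤ ENNReal.ofReal (2 * Real.exp (-(ε ^ 2 * d2) / 2 ^ 2)) := by
  have hd2 : 0 < d2 := by
    rcases Nat.eq_zero_or_pos d2 with h | h
    · subst h; simp at hi
    · exact h
  have hd1 : 0 < d1 := by omega
  obtain ⟨m, hm⟩ := Nat.exists_eq_add_of_lt hd
  have hm' : d1 = d2 + (m + 1) := by omega
  have hnR : (d1 : ℝ) = d2 + ((m + 1 : ℕ) : ℝ) := by rw [hm']; push_cast; ring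
  have hn0 : (0 : ℝ) < d1 := by exact_mod_cast hd1
  have hk0 : (0 : ℝ) < d2 := by exact_mod_cast hd2
  have hkn : (d2 : ℝ) < d1 := by exact_mod_cast hd
  have hv1 : ∑ a, ‖v a‖ ^ 2 = 1 := by
    have := hv
    unfold l2norm at this
    rwa [Real.sqrt_eq_one] at this
  set t : ℝ := (1 + ε) ^ 2 with ht
  have ht1 : 1 < t := by rw [ht]; nlinarith
  have ht0 : 0 < t := by linarith
  let N : (Fin d1 → ℂ) → ℝ := fun x => ∑ a, ‖x a‖ ^ 2
  let B : (Fin d1 → ℂ) → ℝ := fun x => ∑ a : Fin d1, if a.val / d2 = i then ‖x a‖ ^ 2 else 0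
  let A : Set (Fin d1 → ℂ) := {x | t * d2 * N x < d1 * B x}
  have hB : ∀ x, l2norm ((blockProj d1 d2 i).mulVec x) = Real.sqrt (B x) := by
    intro x
    simp only [l2norm, B, blockProj, Matrix.mulVec_diagonal]
    congr 1
    refine Finset.sum_congr rfl fun a _ => ?_
    split_ifs <;> simp
  have hsub : {U : Matrix.unitaryGroup (Fin d1) ℂ |
        (1 + ε) * Real.sqrt ((d2 : ℝ) / d1)
          < l2norm ((blockProj d1 d2 i).mulVec ((U : Matrix (Fin d1) (Fin d1) ℂ).mulVec v))} ⊆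
      {U | (U : Matrix (Fin d1) (Fin d1) ℂ).mulVec v ∈ A} := by
    intro U hU
    simp only [Set.mem_ofPred_eq, hB, A] at hU ⊢
    have hN : N ((U : Matrix (Fin d1) (Fin d1) ℂ).mulVec v) = 1 := (norm_pres U v).trans hv1
    rw [hN, mul_one]
    have h1 := Real.lt_sqrt (by positivity) |>.1 hU
    rw [mul_pow, Real.sq_sqrt (by positivity), ← ht, ← mul_div_assoc, div_lt_iff₀ hn0] at h1
    linarith
  refine (measure_mono hsub).trans ?_
  have hBN : ∀ x, B x ≤ N x := by
    intro x
    refine Finset.sum_le_sum fun a _ => ?_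
    split_ifs
    · exact le_rfl
    · positivity
  have hN0 : ∀ x, 0 ≤ N x := fun x => Finset.sum_nonneg fun a _ => by positivity
  by_cases htk : t * d2 < d1
  swap
  · have : {U : Matrix.unitaryGroup (Fin d1) ℂ |
        (U : Matrix (Fin d1) (Fin d1) ℂ).mulVec v ∈ A} = ∅ := by
      ext U
      simp only [Set.mem_ofPred_eq, A, Set.mem_empty_iff_false, iff_false, not_lt]
      set x := (U : Matrix (Fin d1) (Fin d1) ℂ).mulVec v
      push Not at htk
      have h1 := mul_le_mul_of_nonneg_right htk (hN0 x)
      have h2 := mul_le_mul_of_nonneg_left (hBN x) hn0.le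
      linarith
    rw [this]; simp
  have hNc : Continuous N := by fun_prop
  have hBc : Continuous B := by
    refine continuous_finsetSum _ fun a _ => ?_
    split_ifs <;> fun_prop
  have hA : MeasurableSet A := measurableSet_lt (by fun_prop) (by fun_prop)
  have hcone : ∀ (r : ℝ) (x : Fin d1 → ℂ), 0 < r → x ∈ A → (fun a => (r : ℂ) * x a) ∈ A := by
    intro r x hr hx
    have e1 : N (fun a => (r : ℂ) * x a) = r ^ 2 * N x := by
      simp only [N, norm_mul, mul_pow, Finset.mul_sum, Complex.norm_real, Real.norm_eq_abs, sq_abs]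
    have e2 : B (fun a => (r : ℂ) * x a) = r ^ 2 * B x := by
      simp only [B, norm_mul, mul_pow, Finset.mul_sum, Complex.norm_real, Real.norm_eq_abs, sq_abs,
        mul_ite, mul_zero]
    simp only [A, Set.mem_ofPred_eq, e1, e2] at hx ⊢
    have : 0 < r ^ 2 := by positivity
    nlinarith
  have key := cone_mass μ hd1 hinv v hv1 A hA hcone
  have hD : 0 < (d1 : ℝ) - t * d2 := by linarith
  let c : Fin d1 → ℝ := fun a =>
    if a.val / d2 = i then 1 / t else ((d1 : ℝ) - d2) / (d1 - t * d2)
  have hc : ∀ a, 0 < c a := by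
    intro a
    simp only [c]
    split_ifs
    · positivity
    · exact div_pos (by linarith) hD
  have hsum : ∀ x, ∑ a, c a * ‖x a‖ ^ 2 =
      N x - (t - 1) / (t * (d1 - t * d2)) * (d1 * B x - t * d2 * N x) := by
    intro x
    simp only [N, B, Finset.mul_sum, ← Finset.sum_sub_distrib]
    refine Finset.sum_congr rfl fun a _ => ?_
    simp only [c]
    split_ifs
    · field_simp; ring
    · have hDne : (d1 : ℝ) - t * d2 ≠ 0 := hD.ne'
      obtain ⟨D, hDD⟩ : ∃ D : ℝ, (d1 : ℝ) - t * d2 = D := ⟨_, rfl⟩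
      have hd1D : (d1 : ℝ) = D + t * d2 := by linarith
      rw [hDD] at hDne ⊢
      rw [hd1D]
      field_simp; ring
  have hle : ∫⁻ x : Fin d1 → ℂ,
      A.indicator (fun x => ENNReal.ofReal (Real.exp (-∑ a, ‖x a‖ ^ 2))) x ≤
      ENNReal.ofReal (∏ a, (Real.pi / c a)) := by
    rw [← gauss c hc]
    refine lintegral_mono fun x => ?_
    by_cases hx : x ∈ A
    · rw [Set.indicator_of_mem hx]
      refine ENNReal.ofReal_le_ofReal (Real.exp_le_exp.2 (neg_le_neg ?_))
      rw [hsum]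
      have h1 : 0 < d1 * B x - t * d2 * N x := sub_pos.2 hx
      have h2 : 0 ≤ (t - 1) / (t * (d1 - t * d2)) :=
        div_nonneg (by linarith) (mul_pos ht0 hD).le
      have := mul_nonneg h2 h1.le
      change _ ≤ N x
      linarith
    · rw [Set.indicator_of_notMem hx]; exact zero_le
  have hg1 := gauss (n := d1) (fun _ => 1) (fun _ => one_pos)
  simp only [one_mul, div_one] at hg1
  rw [hg1] at key
  have key2 := key.trans hle
  have hprod : ∏ a, (Real.pi / c a) =
      (t ^ d2 * (((d1 : ℝ) - t * d2) / (d1 - d2)) ^ (m + 1)) * ∏ _a : Fin d1, Real.pi := by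
    have e1 : ∀ a, Real.pi / c a = (if a.val / d2 = i then t else
        ((d1 : ℝ) - t * d2) / (d1 - d2)) * Real.pi := by
      intro a
      simp only [c]
      split_ifs
      · field_simp
      · rw [div_div_eq_mul_div]; ring
    simp_rw [e1]
    rw [Finset.prod_mul_distrib, Finset.prod_ite, Finset.prod_const, Finset.prod_const,
      block_card d1 d2 i hd2 hi]
    have hcard := Finset.card_filter_add_card_filter_not (s := (Finset.univ : Finset (Fin d1)))
      (fun a : Fin d1 => a.val / d2 = i)
    rw [block_card d1 d2 i hd2 hi, Finset.card_univ, Fintype.card_fin] at hcard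
    congr 3
    omega
  have hP : 0 < ∏ _a : Fin d1, Real.pi := Finset.prod_pos fun _ _ => Real.pi_pos
  have hsb := scalar_bound d2 (m + 1) d1 ε hnR hd2 (Nat.succ_pos m) hε htk
  rw [hprod, ENNReal.ofReal_mul' hP.le] at key2
  have hne0 : ENNReal.ofReal (∏ _a : Fin d1, Real.pi) ≠ 0 := (ENNReal.ofReal_pos.2 hP).ne'
  rw [ENNReal.mul_le_mul_iff_left hne0 ENNReal.ofReal_ne_top] at key2
  exact key2.trans (ENNReal.ofReal_le_ofReal hsb)
end
end
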